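/- For every admissible update sequence U, after the SF_4-sketch processes U starting from all-zero subsketches, every counter of the Slim-subsketch is at most the sum of the counters in the corresponding bucket of the Fat-subsketch: for all i : Fin d and j : Fin w, A i j ≤ Σ over k : Fin z of B i j k. (The invariant the paper establishes for SF_4 to justify its deletion operation.) -/

import Mathlib

/-- An update operation: insertion or deletion of an item. -/
inductive SketchOp (ι : Type) where
  | ins (e : ι)
  | del (e : ι)
deriving DecidableEq

/-- The state of the SF_4-sketch: a Slim-subsketch `A` and a Fat-subsketch `B`
with `z` counters per bucket. -/
structure SF4State (d w z : ℕ) where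
  A : Fin d → Fin w → ℕ
  B : Fin d → Fin w → Fin z → ℕ

/-- One update step of the SF_4-sketch.

Insertion of `e`: first each counter `B i (h i e) (g i e)` is incremented by 1;
then, with `Bmin` the minimum over `i` of the updated `B i (h i e) (g i e)`,
every Slim counter `A i (h i e)` whose value equals the minimum over `i'` of
`A i' (h i' e)` and is `< Bmin` is incremented by 1; other Slim counters are
unchanged.

Deletion of `e`: each counter `B i (h i e) (g i e)` is decremented by 1; then
each Slim counter `A i (h i e)` is replaced by
`min (A i (h i e)) (Σ over k of the updated B i (h i e) k)`. -/
def sf4Step {ι : Type} {d w z : ℕ} [NeZero d] (h : Fin d → ι → Fin w)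
    (g : Fin d → ι → Fin z) (st : SF4State d w z) : SketchOp ι → SF4State d w z
  | .ins e =>
      let B' : Fin d → Fin w → Fin z → ℕ :=
        fun i j k => if j = h i e ∧ k = g i e then st.B i j k + 1 else st.B i j k
      let Bmin := Finset.univ.inf' Finset.univ_nonempty
        (fun i => B' i (h i e) (g i e))
      let Amin := Finset.univ.inf' Finset.univ_nonempty
        (fun i' => st.A i' (h i' e))
      let A' : Fin d → Fin w → ℕ :=
        fun i j =>
          if j = h i e ∧ st.A i (h i e) = Amin ∧ st.A i (h i e) < Bmin then
            st.A i j + 1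
          else st.A i j
      ⟨A', B'⟩
  | .del e =>
      let B' : Fin d → Fin w → Fin z → ℕ :=
        fun i j k => if j = h i e ∧ k = g i e then st.B i j k - 1 else st.B i j k
      let A' : Fin d → Fin w → ℕ :=
        fun i j =>
          if j = h i e then
            min (st.A i j) (∑ k : Fin z, B' i (h i e) k)
          else st.A i j
      ⟨A', B'⟩

/-- The state of the SF_4-sketch after processing the update sequence `U`
starting from all-zero subsketches. -/
def sf4Process {ι : Type} {d w z : ℕ} [NeZero d] (h : Fin d → ι → Fin w)
    (g : Fin d → ι → Fin z) (U : List (SketchOp ι)) : SF4State d w z :=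
  U.foldl (sf4Step h g) ⟨fun _ _ => 0, fun _ _ _ => 0⟩

/-- A single step preserves the invariant (admissibility is not even needed). -/
theorem sf4Step_inv {ι : Type} {d w z : ℕ} [NeZero d] (h : Fin d → ι → Fin w)
    (g : Fin d → ι → Fin z) (st : SF4State d w z)
    (hst : ∀ i j, st.A i j ≤ ∑ k : Fin z, st.B i j k) (op : SketchOp ι) :
    ∀ i j, (sf4Step h g st op).A i j ≤ ∑ k : Fin z, (sf4Step h g st op).B i j k := by
  intro i j
  cases op with
  | ins e =>
    simp only [sf4Step, and_self, if_true, true_and]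
    split_ifs with hc
    · obtain ⟨rfl, -, hlt⟩ := hc
      have h1 := (Finset.lt_inf'_iff _).1 hlt i (Finset.mem_univ i)
      have h2 := Finset.single_le_sum
        (f := fun k => if h i e = h i e ∧ k = g i e then st.B i (h i e) k + 1
          else st.B i (h i e) k) (fun _ _ => Nat.zero_le _) (Finset.mem_univ (g i e))
      simp only [and_self, if_true, true_and] at h1 h2 ⊢
      omega
    · refine (hst i j).trans (Finset.sum_le_sum fun k _ => ?_)
      split_ifs <;> omega
  | del e =>
    simp only [sf4Step, and_self, if_true, true_and]
    split_ifs with hc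
    · subst hc
      simp only [true_and]
      exact min_le_right _ _
    · simpa [hc] using hst i j

/-- For every admissible update sequence (immediately before every deletion of
an item `e`, all Fat counters `B i (h i e) (g i e)` are at least 1), after the
SF_4-sketch processes the sequence, every Slim counter is at most the sum of
the counters in the corresponding bucket of the Fat-subsketch. -/
theorem sf4_slim_le_sum_fat {ι : Type} {d w z : ℕ} [NeZero d] [NeZero w]
    [NeZero z] (h : Fin d → ι → Fin w) (g : Fin d → ι → Fin z)
    (U : List (SketchOp ι))
    (hadm : ∀ (V : List (SketchOp ι)) (e : ι) (rest : List (SketchOp ι)),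
      U = V ++ SketchOp.del e :: rest →
      ∀ i : Fin d, 1 ≤ (sf4Process h g V : SF4State d w z).B i (h i e) (g i e)) :
    ∀ (i : Fin d) (j : Fin w),
      (sf4Process h g U : SF4State d w z).A i j
        ≤ ∑ k : Fin z, (sf4Process h g U).B i j k := by
  clear hadm
  induction U using List.reverseRecOn with
  | nil => intro i j; simp [sf4Process]
  | append_singleton V op ih =>
    have hstep : (sf4Process h g (V ++ [op]) : SF4State d w z)
        = sf4Step h g (sf4Process h g V) op := by
      simp [sf4Process]
    rw [hstep]
    exact sf4Step_inv h g _ ih op
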